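/- In the Čech complex $(\mathcal{C}^\bullet(\Delta, \mathscr{O}), \delta)$ associated to the face complex $\Delta$ of a polytope with $\mathcal{V}(\sigma)$ the holomorphic functions on the corresponding stratum $\sigma^\circ$, the kernel of $\delta^0 : \mathcal{C}^0 \to \mathcal{C}^1$ equals the image of the restriction map $\mathscr{O}(X) \to \mathcal{C}^0$; concretely, a tuple $(g_i)$ of holomorphic functions on the top-dimensional components $X_i$ satisfying the codimension-one matching conditions is the restriction of a unique global holomorphic function on $X$, given explicitly by $g = \sum_{\sigma\in\Delta}(-1)^{\dim\sigma}(g_i)|_{\sigma^\circ}$ (each stratum function lifted to $X$ via coordinate projection). -/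

import Mathlib

noncomputable section

/-- The dimension of a polytope (or face) `σ`: the rank of its direction space. -/
def faceDim {n : ℕ} (σ : Set (EuclideanSpace ℝ (Fin n))) : ℕ :=
  Module.finrank ℝ (vectorSpan ℝ σ)

/-- A (nonempty) face of a polytope `P`: a nonempty closed convex extreme subset. -/
def IsPolyFace {n : ℕ} (P F : Set (EuclideanSpace ℝ (Fin n))) : Prop :=
  F.Nonempty ∧ IsExtreme ℝ P F ∧ Convex ℝ F ∧ IsClosed F

/-- The coordinate subspace `ℂ^A ⊆ ℂ^d` of points vanishing outside `A`. -/
def coordSubspace (d : ℕ) (A : Finset (Fin d)) : Set (Fin d → ℂ) :=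
  { z | ∀ t : Fin d, t ∉ A → z t = 0 }

/-- The coordinate projection `ℂ^d → ℂ^A` (zeroing the coordinates outside `A`),
used to lift functions on a stratum to `ℂ^d` and hence to `X`. -/
def coordProj (d : ℕ) (A : Finset (Fin d)) (z : Fin d → ℂ) : Fin d → ℂ :=
  fun t => if t ∈ A then z t else 0

section Polytope

variable {E : Type*} [NormedAddCommGroup E] [NormedSpace ℝ E]

/-- A continuous linear functional on a nonempty compact set attains its maximum at an extreme
point. -/
theorem IsCompact.exists_extremePoint_forall_le {K : Set E} (hK : IsCompact K) (hne : K.Nonempty)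
    (ℓ : E →L[ℝ] ℝ) : ∃ x ∈ K.extremePoints ℝ, ∀ y ∈ K, ℓ y ≤ ℓ x := by
  have hexp : IsExposed ℝ K (ℓ.toExposed K) := ContinuousLinearMap.toExposed.isExposed
  obtain ⟨m, hm, hmax⟩ := hK.exists_isMaxOn hne ℓ.continuous.continuousOn
  obtain ⟨x, hx⟩ := (hexp.isCompact hK).extremePoints_nonempty ⟨m, hm, fun y hy => hmax hy⟩
  exact ⟨x, hexp.isExtreme.extremePoints_subset_extremePoints hx, (extremePoints_subset hx).2⟩

/-- A closed convex extreme subset of a polytope is a polytope. -/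
theorem IsExtreme.exists_finset_eq_convexHull {V : Finset E} {Q : Set E}
    (hQ : IsExtreme ℝ (convexHull ℝ (V : Set E)) Q) (hconv : Convex ℝ Q) (hcl : IsClosed Q) :
    ∃ U : Finset E, Q = convexHull ℝ (U : Set E) := by
  have hfin : (Q.extremePoints ℝ).Finite := V.finite_toSet.subset
    (hQ.extremePoints_subset_extremePoints.trans extremePoints_convexHull_subset)
  have hcomp : IsCompact Q :=
    (V.finite_toSet.isCompact_convexHull ℝ).of_isClosed_subset hcl hQ.subset
  refine ⟨hfin.toFinset, ?_⟩
  rw [hfin.coe_toFinset]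
  conv_lhs => rw [← closure_convexHull_extremePoints hcomp hconv]
  exact (hfin.isClosed_convexHull ℝ).closure_eq

/-- If a linear functional is not maximal on a polytope at a vertex `w`, then it increases along
some edge at `w`. -/
theorem exists_edge_lt_of_mem_extremePoints {U : Finset E} {w x : E}
    (hw : w ∈ (convexHull ℝ (U : Set E)).extremePoints ℝ) (ℓ : E →L[ℝ] ℝ)
    (hx : x ∈ convexHull ℝ (U : Set E)) (hlt : ℓ w < ℓ x) :
    ∃ F, IsExtreme ℝ (convexHull ℝ (U : Set E)) F ∧ Convex ℝ F ∧ IsClosed F ∧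
      Module.finrank ℝ (vectorSpan ℝ F) = 1 ∧ w ∈ F ∧ (∀ q ∈ F, ℓ w ≤ ℓ q) ∧
      ∃ q ∈ F, ℓ w < ℓ q := by
  classical
  set Q := convexHull ℝ (U : Set E) with hQ
  have hQconv : Convex ℝ Q := convex_convexHull ℝ _
  have hQcomp : IsCompact Q := U.finite_toSet.isCompact_convexHull ℝ
  have hxw : x ≠ w := fun h => by simp [h] at hlt
  have hwU : w ∈ U := extremePoints_convexHull_subset hw
  have hwQ : w ∈ Q := extremePoints_subset hw
  set T : Set E := convexHull ℝ ((U.erase w : Finset E) : Set E) with hT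
  have hwT : w ∉ T := fun h => (hQconv.mem_extremePoints_iff_mem_sdiff_convexHull_sdiff.1 hw).2
    (convexHull_mono (fun y hy => by
      have hy' := Finset.mem_erase.1 (Finset.mem_coe.1 hy)
      exact ⟨subset_convexHull ℝ _ hy'.2, hy'.1⟩) h)
  obtain ⟨f, u, hfw, hfT⟩ := geometric_hahn_banach_point_closed (convex_convexHull ℝ _)
    ((U.erase w).finite_toSet.isClosed_convexHull ℝ) hwT
  have hTQ : T ⊆ Q := convexHull_mono (Finset.coe_subset.2 (Finset.erase_subset _ _))
  have hε : 0 < u - f w := sub_pos.2 hfw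
  have hcone : ∀ a ∈ Q, a ≠ w → ∃ b ∈ T, ∃ t : ℝ, 0 < t ∧ a - w = t • (b - w) := by
    intro a ha haw
    rw [hQ, ← Finset.insert_erase hwU, Finset.coe_insert] at ha
    rcases (U.erase w).eq_empty_or_nonempty with h0 | hne
    · simp [h0] at ha; exact absurd ha haw
    rw [convexHull_insert (Finset.coe_nonempty.2 hne), mem_convexJoin] at ha
    obtain ⟨w', rfl, b, hb, α, β, hα, hβ, hαβ, rfl⟩ := ha
    refine ⟨b, hb, β, hβ.lt_of_ne' fun h => haw ?_, ?_⟩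
    · rw [h, add_zero] at hαβ; simp [h, hαβ]
    · rw [eq_sub_of_add_eq hαβ]; module
  have hfpos : ∀ a ∈ Q, a ≠ w → 0 < f a - f w := by
    intro a ha haw
    obtain ⟨b, hb, t, ht, h⟩ := hcone a ha haw
    rw [← map_sub, h, map_smul, map_sub, smul_eq_mul]
    have := hfT b hb
    exact mul_pos ht (by linarith)
  have hfnonneg : ∀ a ∈ Q, 0 ≤ f a - f w := fun a ha => by
    rcases eq_or_ne a w with rfl | h
    · simp
    · exact (hfpos a ha h).le
  set K : Set E := Q ∩ {p | f p = u} with hK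
  have hKcomp : IsCompact K := hQcomp.inter_right (isClosed_eq f.continuous continuous_const)
  -- radial projection from `w` onto the section `K`
  have hproj : ∀ a ∈ Q, a ≠ w → ∃ p ∈ K, a - w = ((f a - f w) / (u - f w)) • (p - w) := by
    intro a ha haw
    obtain ⟨b, hb, t, ht, h⟩ := hcone a ha haw
    have hbu := hfT b hb
    have hb0 : 0 < f b - f w := by linarith
    have hfa : f a - f w = t * (f b - f w) := by
      rw [← map_sub, h, map_smul, map_sub, smul_eq_mul]
    refine ⟨w + ((u - f w) / (f b - f w)) • (b - w), ⟨?_, ?_⟩, ?_⟩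
    · refine hQconv.add_smul_sub_mem hwQ (hTQ hb) ⟨by positivity, ?_⟩
      rw [div_le_one hb0]; linarith
    · simp only [Set.mem_ofPred_eq, map_add, map_smul, map_sub, smul_eq_mul]
      field_simp; ring
    · rw [add_sub_cancel_left, smul_smul, h, hfa]
      congr 1
      field_simp
  obtain ⟨px, hpx, hpx'⟩ := hproj x hx hxw
  obtain ⟨p, hp, hpmax⟩ := hKcomp.exists_extremePoint_forall_le ⟨px, hpx⟩ ℓ
  have hpK : p ∈ K := extremePoints_subset hp
  have hℓp : ℓ w < ℓ p := by
    have h1 : ℓ x - ℓ w = ((f x - f w) / (u - f w)) * (ℓ px - ℓ w) := by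
      rw [← map_sub, hpx', map_smul, map_sub, smul_eq_mul]
    have h2 : 0 < ℓ px - ℓ w := by
      by_contra! h
      have := mul_nonpos_of_nonneg_of_nonpos (div_pos (hfpos x hx hxw) hε).le h
      linarith
    linarith [hpmax px hpx]
  set F : Set E := Q ∩ {q | (u - f w) • (q - w) = (f q - f w) • (p - w)} with hF
  have hFmem : ∀ q ∈ Q, ∀ t : ℝ, q - w = t • (p - w) → q ∈ F := by
    intro q hq t h
    have hfq : f q - f w = t * (u - f w) := by
      rw [← map_sub, h, map_smul, map_sub, smul_eq_mul, hpK.2]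
    refine ⟨hq, ?_⟩
    simp only [Set.mem_ofPred_eq]
    rw [hfq, h, smul_smul, mul_comm]
  have hFray : ∀ q ∈ F, q - w = ((f q - f w) / (u - f w)) • (p - w) := by
    rintro q ⟨-, hq⟩
    have h : (u - f w) • (q - w) = (f q - f w) • (p - w) := hq
    rw [div_eq_inv_mul, mul_smul, ← h, smul_smul, inv_mul_cancel₀ hε.ne', one_smul]
  have hwF : w ∈ F := hFmem w hwQ 0 (by simp)
  have hpF : p ∈ F := hFmem p hpK.1 1 (by simp)
  refine ⟨F, ⟨Set.inter_subset_left, ?_⟩, hQconv.inter ?_, hQcomp.isClosed.inter ?_, ?_, hwF, ?_,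
    p, hpF, hℓp⟩
  · rintro a ha b hb q hq ⟨α, β, hα, hβ, hαβ, rfl⟩
    have hcomb : (α • a + β • b) - w = α • (a - w) + β • (b - w) := by
      rw [eq_sub_of_add_eq hαβ]; module
    rcases eq_or_ne a w with rfl | haw
    · exact hwF
    rcases eq_or_ne b w with rfl | hbw
    · rw [sub_self, smul_zero, add_zero] at hcomb
      refine hFmem a ha (α⁻¹ * ((f (α • a + β • b) - f b) / (u - f b))) ?_
      rw [mul_smul, ← hFray _ hq, hcomb, smul_smul, inv_mul_cancel₀ hα.ne', one_smul]
    obtain ⟨pa, hpa, ha'⟩ := hproj a ha haw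
    obtain ⟨pb, hpb, hb'⟩ := hproj b hb hbw
    have hfa := hfpos a ha haw
    have hfb := hfpos b hb hbw
    have hfq : f (α • a + β • b) - f w = α * (f a - f w) + β * (f b - f w) := by
      rw [← map_sub, hcomb]; simp
    set t := α * (f a - f w) + β * (f b - f w) with ht
    have ht0 : 0 < t := by positivity
    have hray := hFray _ hq
    rw [hfq, hcomb, ha', hb', smul_smul, smul_smul] at hray
    have hpp : pa = p := by
      refine hp.2 hpa hpb ⟨α * (f a - f w) / t, β * (f b - f w) / t, by positivity, by positivity,
        by rw [← add_div, ← ht, div_self ht0.ne'], ?_⟩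
      have h1 : (α * (f a - f w) / t) • (pa - w) + (β * (f b - f w) / t) • (pb - w) = p - w := by
        have := congrArg (fun v => ((u - f w) / t) • v) hray
        simp only [smul_add, smul_smul] at this
        rw [show (u - f w) / t * (t / (u - f w)) = 1 by field_simp, one_smul] at this
        rw [← this]
        congr 2 <;> field_simp
      have h2 : α * (f a - f w) / t + β * (f b - f w) / t = 1 := by
        rw [← add_div, ← ht, div_self ht0.ne']
      have h3 := eq_add_of_sub_eq h1.symm
      rw [h3, eq_sub_of_add_eq h2]
      module
    exact hFmem a ha _ (hpp ▸ ha')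
  · intro a ha b hb α β _ _ hαβ
    simp only [Set.mem_ofPred_eq] at ha hb ⊢
    have h1 : (α • a + β • b) - w = α • (a - w) + β • (b - w) := by
      rw [eq_sub_of_add_eq hαβ]; module
    have h2 : f (α • a + β • b) - f w = α * (f a - f w) + β * (f b - f w) := by
      rw [← map_sub, h1]; simp
    rw [h1, h2, smul_add, smul_comm _ α, ha, smul_comm _ β, hb]
    module
  · exact isClosed_eq (by fun_prop) (by fun_prop)
  · have hspan : vectorSpan ℝ F = Submodule.span ℝ {p - w} := by
      rw [vectorSpan_eq_span_vsub_set_right ℝ hwF]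
      refine le_antisymm (Submodule.span_le.2 ?_) (Submodule.span_mono ?_)
      · rintro _ ⟨q, hq, rfl⟩
        simp only [vsub_eq_sub, SetLike.mem_coe]
        rw [hFray q hq]
        exact Submodule.smul_mem _ _ (Submodule.mem_span_singleton_self _)
      · rintro _ rfl
        exact ⟨p, hpF, rfl⟩
    rw [hspan, finrank_span_singleton]
    exact sub_ne_zero.2 fun h => by simp [h] at hℓp
  · intro q hq
    have h := congrArg ℓ (hFray q hq)
    rw [map_smul, map_sub, map_sub, smul_eq_mul] at h
    have := mul_nonneg (div_nonneg (hfnonneg q hq.1) hε.le) (sub_pos.2 hℓp).le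
    linarith

/-- Some linear functional separates the points of a finite set. -/
theorem Finset.exists_clm_injOn [FiniteDimensional ℝ E] (V : Finset E) :
    ∃ ℓ : E →L[ℝ] ℝ, Set.InjOn ℓ V := by
  obtain ⟨ℓ, hℓ⟩ := Module.exists_dual_forall_apply_ne_zero (K := ℝ)
    (fun p : {p : V × V // (p.1 : E) ≠ p.2} => (p.1.1 : E) - p.1.2) fun p => sub_ne_zero.2 p.2
  refine ⟨LinearMap.toContinuousLinearMap ℓ, fun x hx y hy hxy => ?_⟩
  by_contra h
  refine hℓ ⟨(⟨x, hx⟩, ⟨y, hy⟩), h⟩ ?_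
  simpa [sub_eq_zero] using hxy

end Polytope

section Faces

variable {n d : ℕ}

theorem faceDim_singleton (w : EuclideanSpace ℝ (Fin n)) : faceDim {w} = 0 := by
  simp [faceDim]

theorem exists_eq_singleton_of_faceDim_eq_zero {F : Set (EuclideanSpace ℝ (Fin n))}
    (hne : F.Nonempty) (hF : faceDim F = 0) : ∃ w, F = {w} := by
  rw [faceDim, Submodule.finrank_eq_zero, vectorSpan_eq_bot_iff_subsingleton] at hF
  obtain ⟨w, hw⟩ := hne
  exact ⟨w, hF.eq_singleton_of_mem hw⟩

/-- `Δ` is the set of nonempty faces of the full-dimensional polytope `convexHull V`, and `c` is an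
order-reversing embedding of `Δ` into the subsets of `Fin d`, whose image is closed under
intersections and which turns dimension into codimension. -/
structure IsFaceCoding (V : Finset (EuclideanSpace ℝ (Fin n)))
    (Δ : Finset (Set (EuclideanSpace ℝ (Fin n))))
    (c : Set (EuclideanSpace ℝ (Fin n)) → Finset (Fin d)) : Prop where
  full : faceDim (convexHull ℝ (V : Set (EuclideanSpace ℝ (Fin n)))) = n
  mem_iff : ∀ F, F ∈ Δ ↔ IsPolyFace (convexHull ℝ (V : Set (EuclideanSpace ℝ (Fin n)))) F
  inj : ∀ σ ∈ Δ, ∀ τ ∈ Δ, c σ = c τ → σ = τ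
  rev : ∀ σ ∈ Δ, ∀ τ ∈ Δ, (σ ⊆ τ ↔ c τ ⊆ c σ)
  card : ∀ σ ∈ Δ, (c σ).card + faceDim σ = n
  inter : ∀ σ ∈ Δ, ∀ τ ∈ Δ, ∀ ρ ∈ Δ, σ ⊆ ρ → τ ⊆ ρ → ∃ υ ∈ Δ, c υ = c σ ∩ c τ

namespace IsFaceCoding

variable {V : Finset (EuclideanSpace ℝ (Fin n))} {Δ : Finset (Set (EuclideanSpace ℝ (Fin n)))}
  {c : Set (EuclideanSpace ℝ (Fin n)) → Finset (Fin d)} {F Q : Set (EuclideanSpace ℝ (Fin n))}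
  {w x : EuclideanSpace ℝ (Fin n)}

theorem mem_of_isExtreme (h : IsFaceCoding V Δ c) (hQ : Q ∈ Δ) (hne : F.Nonempty)
    (hF : IsExtreme ℝ Q F) (hconv : Convex ℝ F) (hcl : IsClosed F) : F ∈ Δ :=
  (h.mem_iff F).2 ⟨hne, ((h.mem_iff Q).1 hQ).2.1.trans hF, hconv, hcl⟩

theorem convexHull_mem (h : IsFaceCoding V Δ c) (hF : F ∈ Δ) :
    convexHull ℝ (V : Set (EuclideanSpace ℝ (Fin n))) ∈ Δ := by
  have hF := (h.mem_iff F).1 hF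
  exact (h.mem_iff _).2 ⟨hF.1.mono hF.2.1.subset, .rfl, convex_convexHull ℝ _,
    V.finite_toSet.isClosed_convexHull ℝ⟩

theorem singleton_mem_iff (h : IsFaceCoding V Δ c) : {w} ∈ Δ ↔
    w ∈ (convexHull ℝ (V : Set (EuclideanSpace ℝ (Fin n)))).extremePoints ℝ := by
  rw [h.mem_iff, ← isExtreme_singleton]
  exact ⟨fun h => h.2.1, fun h => ⟨Set.singleton_nonempty w, h, convex_singleton w,
    isClosed_singleton⟩⟩

theorem mem_extremePoints (h : IsFaceCoding V Δ c) (hw : {w} ∈ Δ) (hF : F ∈ Δ) (hwF : w ∈ F) :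
    w ∈ F.extremePoints ℝ :=
  inter_extremePoints_subset_extremePoints_of_subset ((h.mem_iff F).1 hF).2.1.subset
    ⟨hwF, h.singleton_mem_iff.1 hw⟩

theorem mem_vertices (h : IsFaceCoding V Δ c) (hw : {w} ∈ Δ) : w ∈ V :=
  extremePoints_convexHull_subset (h.singleton_mem_iff.1 hw)

theorem card_singleton (h : IsFaceCoding V Δ c) (hw : {w} ∈ Δ) : (c {w}).card = n := by
  simpa [faceDim_singleton] using h.card _ hw

theorem subset_singleton_iff (h : IsFaceCoding V Δ c) (hw : {w} ∈ Δ) (hF : F ∈ Δ) :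
    c F ⊆ c {w} ↔ w ∈ F := by
  rw [← h.rev _ hw _ hF, Set.singleton_subset_iff]

theorem exists_vertex_forall_le (h : IsFaceCoding V Δ c) (hF : F ∈ Δ)
    (ℓ : EuclideanSpace ℝ (Fin n) →L[ℝ] ℝ) : ∃ w ∈ F, {w} ∈ Δ ∧ ∀ y ∈ F, ℓ y ≤ ℓ w := by
  have hF' := (h.mem_iff F).1 hF
  have hcomp : IsCompact F :=
    (V.finite_toSet.isCompact_convexHull ℝ).of_isClosed_subset hF'.2.2.2 hF'.2.1.subset
  obtain ⟨w, hw, hmax⟩ := hcomp.exists_extremePoint_forall_le hF'.1 ℓ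
  exact ⟨w, extremePoints_subset hw,
    h.singleton_mem_iff.2 (hF'.2.1.extremePoints_subset_extremePoints hw), hmax⟩

theorem exists_edge (h : IsFaceCoding V Δ c) (hw : {w} ∈ Δ) (hF : F ∈ Δ) (hwF : w ∈ F)
    (ℓ : EuclideanSpace ℝ (Fin n) →L[ℝ] ℝ) (hx : x ∈ F) (hlt : ℓ w < ℓ x) :
    ∃ e ∈ Δ, e ⊆ F ∧ faceDim e = 1 ∧ w ∈ e ∧ (∀ q ∈ e, ℓ w ≤ ℓ q) ∧ ∃ q ∈ e, ℓ w < ℓ q := by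
  have hF' := (h.mem_iff F).1 hF
  have hwx := h.mem_extremePoints hw hF hwF
  obtain ⟨U, hU⟩ := hF'.2.1.exists_finset_eq_convexHull hF'.2.2.1 hF'.2.2.2
  rw [hU] at hx hwx
  obtain ⟨e, he, hconv, hcl, hdim, hwe, hle, hq⟩ := exists_edge_lt_of_mem_extremePoints hwx ℓ hx hlt
  rw [← hU] at he
  exact ⟨e, h.mem_of_isExtreme hF ⟨w, hwe⟩ he hconv hcl, he.subset, hdim, hwe, hle, hq⟩

theorem exists_eq_erase (h : IsFaceCoding V Δ c) (hw : {w} ∈ Δ) (hF : F ∈ Δ) (hwF : w ∈ F)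
    (hdim : faceDim F = 1) : ∃ t ∈ c {w}, c F = (c {w}).erase t := by
  have h1 := (h.subset_singleton_iff hw hF).2 hwF
  have h2 := h.card _ hF
  have h3 := h.card_singleton hw
  obtain ⟨t, ht, hins⟩ := Finset.exists_eq_insert_iff.2 ⟨h1, by omega⟩
  exact ⟨t, hins ▸ Finset.mem_insert_self _ _, by rw [← hins, Finset.erase_insert ht]⟩

/-- The polytope is simple: every facet through a vertex `w` misses some edge at `w`. -/
theorem exists_edge_eq_erase (h : IsFaceCoding V Δ c) (hw : {w} ∈ Δ) {t : Fin d}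
    (ht : t ∈ c {w}) : ∃ e ∈ Δ, w ∈ e ∧ c e = (c {w}).erase t := by
  classical
  set P := convexHull ℝ (V : Set (EuclideanSpace ℝ (Fin n))) with hP
  have hPΔ : P ∈ Δ := h.convexHull_mem hw
  have hwP : w ∈ P := extremePoints_subset (h.singleton_mem_iff.1 hw)
  set 𝓔 := {e ∈ Δ | w ∈ e ∧ faceDim e = 1} with h𝓔
  have hn : n ≤ 𝓔.card := by
    by_contra! hlt
    have hdir : ∀ e ∈ 𝓔, ∃ k, ∀ q ∈ e, ∃ s : ℝ, s • k = q - w := by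
      intro e he
      obtain ⟨-, hwe, hdim⟩ := Finset.mem_filter.1 he
      obtain ⟨k, -, hk⟩ := finrank_eq_one_iff'.1 hdim
      refine ⟨k, fun q hq => ?_⟩
      obtain ⟨s, hs⟩ := hk ⟨q - w, vsub_mem_vectorSpan ℝ hq hwe⟩
      exact ⟨s, congrArg Subtype.val hs⟩
    choose! k hk using hdir
    have hS : Submodule.span ℝ ((𝓔.image k : Finset _) : Set (EuclideanSpace ℝ (Fin n))) < ⊤ := by
      refine lt_top_iff_ne_top.2 fun htop => ?_
      have h1 := finrank_span_finset_le_card (R := ℝ) (𝓔.image k)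
      rw [Set.finrank, htop, finrank_top, finrank_euclideanSpace_fin] at h1
      exact absurd (h1.trans Finset.card_image_le) (by omega)
    obtain ⟨ℓ₀, hℓ₀, hker⟩ := Submodule.exists_le_ker_of_lt_top _ hS
    set ℓ : EuclideanSpace ℝ (Fin n) →L[ℝ] ℝ := LinearMap.toContinuousLinearMap ℓ₀ with hℓ
    have hconst : ∀ e ∈ Δ, w ∈ e → faceDim e = 1 → ∀ q ∈ e, ℓ q = ℓ w := by
      intro e he hwe hdim q hq
      have he' : e ∈ 𝓔 := Finset.mem_filter.2 ⟨he, hwe, hdim⟩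
      obtain ⟨s, hs⟩ := hk e he' q hq
      have hke : ℓ₀ (k e) = 0 :=
        hker (Submodule.subset_span (Finset.mem_coe.2 (Finset.mem_image_of_mem k he')))
      have : ℓ₀ (q - w) = 0 := by rw [← hs, map_smul, hke, smul_zero]
      rwa [map_sub, sub_eq_zero] at this
    have hle : ∀ m : EuclideanSpace ℝ (Fin n) →L[ℝ] ℝ, (∀ e ∈ Δ, w ∈ e → faceDim e = 1 →
        ∀ q ∈ e, m q = m w) → ∀ y ∈ P, m y ≤ m w := by
      intro m hm y hy
      by_contra! hlt
      obtain ⟨e, he, -, hdim, hwe, -, q, hq, hwq⟩ := h.exists_edge hw hPΔ hwP m hy hlt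
      exact hwq.ne' (hm e he hwe hdim q hq)
    have heq : ∀ y ∈ P, ℓ y = ℓ w := fun y hy => le_antisymm (hle ℓ hconst y hy) <| by
      simpa using hle (-ℓ) (fun e he hwe hdim q hq => by simp [hconst e he hwe hdim q hq]) y hy
    have htop : vectorSpan ℝ P = ⊤ := Submodule.eq_top_of_finrank_eq <| by
      rw [finrank_euclideanSpace_fin]; exact h.full
    have hPker : vectorSpan ℝ P ≤ LinearMap.ker ℓ₀ := by
      rw [vectorSpan_eq_span_vsub_set_right ℝ hwP, Submodule.span_le]
      rintro _ ⟨y, hy, rfl⟩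
      have hy' : ℓ₀ y = ℓ₀ w := heq y hy
      simpa [sub_eq_zero] using hy'
    exact hℓ₀ (LinearMap.ker_eq_top.1 (top_le_iff.1 (htop ▸ hPker)))
  have hsub : 𝓔.image c ⊆ (c {w}).powersetCard (n - 1) := by
    intro A hA
    obtain ⟨e, he, rfl⟩ := Finset.mem_image.1 hA
    obtain ⟨he, hwe, hdim⟩ := Finset.mem_filter.1 he
    have := h.card e he
    exact Finset.mem_powersetCard.2 ⟨(h.subset_singleton_iff hw he).2 hwe, by omega⟩
  have hpos : 0 < n := h.card_singleton hw ▸ Finset.card_pos.2 ⟨t, ht⟩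
  have heq := Finset.eq_of_subset_of_card_le hsub <| by
    rw [Finset.card_powersetCard, h.card_singleton hw, Finset.card_image_of_injOn]
    · rwa [Nat.choose_symm hpos, Nat.choose_one_right]
    · intro e he e' he' hee'
      exact h.inj _ (Finset.mem_filter.1 he).1 _ (Finset.mem_filter.1 he').1 hee'
  have hmem : (c {w}).erase t ∈ 𝓔.image c := by
    rw [heq, Finset.mem_powersetCard, Finset.card_erase_of_mem ht, h.card_singleton hw]
    exact ⟨Finset.erase_subset _ _, rfl⟩
  obtain ⟨e, he, hce⟩ := Finset.mem_image.1 hmem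
  exact ⟨e, (Finset.mem_filter.1 he).1, (Finset.mem_filter.1 he).2.1, hce⟩

theorem exists_eq_of_subset (h : IsFaceCoding V Δ c) (hw : {w} ∈ Δ) {A : Finset (Fin d)}
    (hA : A ⊆ c {w}) : ∃ F ∈ Δ, w ∈ F ∧ c F = A := by
  suffices H : ∀ B : Finset (Fin d), B ⊆ c {w} → ∃ F ∈ Δ, c F = c {w} \ B by
    obtain ⟨F, hF, hcF⟩ := H (c {w} \ A) Finset.sdiff_subset
    rw [Finset.sdiff_sdiff_eq_self hA] at hcF
    exact ⟨F, hF, (h.subset_singleton_iff hw hF).1 (hcF ▸ hA), hcF⟩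
  intro B
  induction B using Finset.induction with
  | empty => exact fun _ => ⟨{w}, hw, by simp⟩
  | insert t B _ ih =>
    intro hB
    obtain ⟨F, hF, hcF⟩ := ih ((Finset.subset_insert _ _).trans hB)
    obtain ⟨e, he, -, hce⟩ := h.exists_edge_eq_erase hw (hB (Finset.mem_insert_self _ _))
    obtain ⟨υ, hυ, hcυ⟩ := h.inter _ hF _ he _ (h.convexHull_mem hw)
      ((h.mem_iff _).1 hF).2.1.subset ((h.mem_iff _).1 he).2.1.subset
    refine ⟨υ, hυ, ?_⟩
    rw [hcυ, hcF, hce]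
    grind

/-- The signed count of the faces of `Q` on which a generic linear functional is maximal at the
vertex `w` vanishes unless `w` minimizes the functional on `Q`. -/
theorem sum_neg_one_pow_faceDim_of_max (h : IsFaceCoding V Δ c) (hw : {w} ∈ Δ) (hQ : Q ∈ Δ)
    (hwQ : w ∈ Q) {ℓ : EuclideanSpace ℝ (Fin n) →L[ℝ] ℝ} (hℓ : Set.InjOn ℓ V) :
    open Classical in
    ∑ F ∈ Δ with F ⊆ Q ∧ w ∈ F ∧ ∀ y ∈ F, ℓ y ≤ ℓ w, (-1 : ℤ) ^ faceDim F =
      if ∀ y ∈ Q, ℓ w ≤ ℓ y then 1 else 0 := by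
  classical
  set D := {t ∈ c {w} \ c Q | ∀ e ∈ Δ, c e = (c {w}).erase t → ∀ y ∈ e, ℓ y ≤ ℓ w} with hD
  have hsum : ∑ F ∈ Δ with F ⊆ Q ∧ w ∈ F ∧ ∀ y ∈ F, ℓ y ≤ ℓ w, (-1 : ℤ) ^ faceDim F =
      ∑ B ∈ D.powerset, (-1 : ℤ) ^ B.card := by
    refine Finset.sum_nbij (fun F => c {w} \ c F) ?_ ?_ ?_ ?_
    · intro F hF
      obtain ⟨hF, hFQ, hwF, hmax⟩ := Finset.mem_filter.1 hF
      have hQF := (h.rev _ hF _ hQ).1 hFQ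
      have hFw := (h.subset_singleton_iff hw hF).2 hwF
      refine Finset.mem_powerset.2 fun t ht => Finset.mem_filter.2
        ⟨Finset.sdiff_subset_sdiff subset_rfl hQF ht, ?_⟩
      intro e he hce y hy
      refine hmax y ((h.rev _ he _ hF).2 ?_ hy)
      rw [hce]
      exact Finset.subset_erase.2 ⟨hFw, (Finset.mem_sdiff.1 ht).2⟩
    · intro F hF F' hF' hFF'
      obtain ⟨hF, -, hwF, -⟩ := Finset.mem_filter.1 hF
      obtain ⟨hF', -, hwF', -⟩ := Finset.mem_filter.1 hF'
      have h1 := (h.subset_singleton_iff hw hF).2 hwF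
      have h2 := (h.subset_singleton_iff hw hF').2 hwF'
      refine h.inj _ hF _ hF' ?_
      rw [← Finset.sdiff_sdiff_eq_self h1, ← Finset.sdiff_sdiff_eq_self h2]
      exact congrArg (c {w} \ ·) hFF'
    · intro B hB
      have hB : B ⊆ D := Finset.mem_powerset.1 hB
      have hBw : B ⊆ c {w} := fun t ht =>
        (Finset.mem_sdiff.1 (Finset.mem_filter.1 (hB ht)).1).1
      obtain ⟨F, hF, hwF, hcF⟩ := h.exists_eq_of_subset hw
        (Finset.sdiff_subset : c {w} \ B ⊆ c {w})
      refine ⟨F, Finset.mem_coe.2 (Finset.mem_filter.2 ⟨hF, ?_, hwF, ?_⟩), ?_⟩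
      · rw [h.rev _ hF _ hQ, hcF]
        intro t ht
        refine Finset.mem_sdiff.2 ⟨(h.subset_singleton_iff hw hQ).2 hwQ ht, fun htB => ?_⟩
        exact (Finset.mem_sdiff.1 (Finset.mem_filter.1 (hB htB)).1).2 ht
      · intro y hy
        by_contra! hlt
        obtain ⟨e, he, heF, hdim, hwe, -, q, hq, hlt⟩ := h.exists_edge hw hF hwF ℓ hy hlt
        obtain ⟨t, ht, hce⟩ := h.exists_eq_erase hw he hwe hdim
        have htB : t ∈ B := by
          have := (h.rev _ he _ hF).1 heF
          rw [hce, hcF] at this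
          by_contra htB
          exact Finset.notMem_erase t _ (this (Finset.mem_sdiff.2 ⟨ht, htB⟩))
        exact (((Finset.mem_filter.1 (hB htB)).2 e he hce q hq).trans_lt hlt).false
      · simp only [hcF]
        exact Finset.sdiff_sdiff_eq_self hBw
    · intro F hF
      obtain ⟨hF, -, hwF, -⟩ := Finset.mem_filter.1 hF
      rw [Finset.card_sdiff_of_subset ((h.subset_singleton_iff hw hF).2 hwF), h.card_singleton hw]
      have := h.card F hF
      congr 1
      omega
  rw [hsum, Finset.sum_powerset_neg_one_pow_card]
  congr 1
  rw [eq_iff_iff, Finset.eq_empty_iff_forall_notMem]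
  constructor
  · intro hD0 y hy
    by_contra! hlt
    obtain ⟨e, he, heQ, hdim, hwe, hle, -⟩ := h.exists_edge hw hQ hwQ (-ℓ) hy (by simpa using hlt)
    obtain ⟨t, ht, hce⟩ := h.exists_eq_erase hw he hwe hdim
    refine hD0 t (Finset.mem_filter.2 ⟨Finset.mem_sdiff.2 ⟨ht, fun htQ => ?_⟩, ?_⟩)
    · have := (h.rev _ he _ hQ).1 heQ htQ
      rw [hce] at this
      exact Finset.notMem_erase t _ this
    · intro e' he' hce' y hy
      rw [← h.inj _ he _ he' (hce.trans hce'.symm)] at hy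
      simpa using hle y hy
  · intro hmin t htD
    obtain ⟨htwQ, htD⟩ := Finset.mem_filter.1 htD
    obtain ⟨ht, htQ⟩ := Finset.mem_sdiff.1 htwQ
    obtain ⟨e, he, hwe, hce⟩ := h.exists_edge_eq_erase hw ht
    have heQ : e ⊆ Q := (h.rev _ he _ hQ).2 <| by
      rw [hce]
      exact fun s hs => Finset.mem_erase.2 ⟨fun hst => htQ (hst ▸ hs),
        (h.subset_singleton_iff hw hQ).2 hwQ hs⟩
    -- `ℓ` is constant on the edge `e`, so `w` is its only vertex
    have hsub : e ⊆ {w} := by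
      have hconst : ∀ y ∈ e, ℓ y = ℓ w := fun y hy =>
        le_antisymm (htD e he hce y hy) (hmin y (heQ hy))
      have hext : e.extremePoints ℝ ⊆ {w} := fun y hy => by
        have hyΔ : {y} ∈ Δ := h.singleton_mem_iff.2
          (((h.mem_iff e).1 he).2.1.extremePoints_subset_extremePoints hy)
        exact hℓ (h.mem_vertices hyΔ) (h.mem_vertices hw) (hconst y (extremePoints_subset hy))
      have he' := (h.mem_iff e).1 he
      have hcomp : IsCompact e :=
        (V.finite_toSet.isCompact_convexHull ℝ).of_isClosed_subset he'.2.2.2 he'.2.1.subset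
      rw [← closure_convexHull_extremePoints hcomp he'.2.2.1]
      exact closure_minimal (convexHull_min hext (convex_singleton w)) isClosed_singleton
    have hcw := (h.rev _ he _ hw).1 hsub ht
    rw [hce] at hcw
    exact Finset.notMem_erase t _ hcw

/-- **Euler's relation** for the faces of a face `Q`. -/
theorem sum_neg_one_pow_faceDim (h : IsFaceCoding V Δ c) (hQ : Q ∈ Δ) :
    open Classical in ∑ F ∈ Δ with F ⊆ Q, (-1 : ℤ) ^ faceDim F = 1 := by
  classical
  obtain ⟨ℓ, hℓ⟩ := V.exists_clm_injOn
  choose! top htop_mem htop_vert htop_max using fun F (hF : F ∈ Δ) =>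
    h.exists_vertex_forall_le hF ℓ
  obtain ⟨w₀, hw₀Q, hw₀, hmin⟩ := h.exists_vertex_forall_le hQ (-ℓ)
  have hmin : ∀ y ∈ Q, ℓ w₀ ≤ ℓ y := by simpa using hmin
  set W := {w ∈ V | {w} ∈ Δ ∧ w ∈ Q} with hW
  have hmaps : ∀ F ∈ ({F ∈ Δ | F ⊆ Q} : Finset _), top F ∈ W := by
    intro F hF
    obtain ⟨hF, hFQ⟩ := Finset.mem_filter.1 hF
    exact Finset.mem_filter.2 ⟨h.mem_vertices (htop_vert F hF), htop_vert F hF,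
      hFQ (htop_mem F hF)⟩
  rw [← Finset.sum_fiberwise_of_maps_to hmaps]
  have hfib : ∀ w ∈ W, ∑ F ∈ {F ∈ Δ | F ⊆ Q} with top F = w, (-1 : ℤ) ^ faceDim F =
      if ∀ y ∈ Q, ℓ w ≤ ℓ y then 1 else 0 := by
    intro w hw
    obtain ⟨hwV, hw, hwQ⟩ := Finset.mem_filter.1 hw
    rw [← h.sum_neg_one_pow_faceDim_of_max hw hQ hwQ hℓ]
    refine Finset.sum_congr ?_ fun _ _ => rfl
    ext F
    simp only [Finset.mem_filter]
    constructor
    · rintro ⟨⟨hF, hFQ⟩, rfl⟩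
      exact ⟨hF, hFQ, htop_mem F hF, htop_max F hF⟩
    · rintro ⟨hF, hFQ, hwF, hmax⟩
      exact ⟨⟨hF, hFQ⟩, hℓ (h.mem_vertices (htop_vert F hF)) hwV
        (le_antisymm (hmax _ (htop_mem F hF)) (htop_max F hF w hwF))⟩
  rw [Finset.sum_congr rfl hfib, Finset.sum_eq_single w₀, if_pos hmin]
  · intro w hw hne
    obtain ⟨hwV, hw, hwQ⟩ := Finset.mem_filter.1 hw
    refine if_neg fun hmin' => hne ?_
    exact hℓ hwV (h.mem_vertices hw₀) (le_antisymm (hmin' w₀ hw₀Q) (hmin w hwQ))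
  · exact fun hn => absurd (Finset.mem_filter.2 ⟨h.mem_vertices hw₀, hw₀, hw₀Q⟩) hn

/-- A family of values attached to the vertices that agrees along the edges of a face `F` is
constant on the vertices of `F`, since the edge graph of `F` is connected. -/
theorem eq_of_forall_edge (h : IsFaceCoding V Δ c) (hF : F ∈ Δ) {α : Type*}
    (f : EuclideanSpace ℝ (Fin n) → α)
    (hf : ∀ u v, {u} ∈ Δ → {v} ∈ Δ → u ∈ F → v ∈ F → (c {u} ∩ c {v}).card = n - 1 → f u = f v)
    {u v : EuclideanSpace ℝ (Fin n)} (hu : {u} ∈ Δ) (hv : {v} ∈ Δ) (huF : u ∈ F) (hvF : v ∈ F) :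
    f u = f v := by
  classical
  obtain ⟨ℓ, hℓ⟩ := V.exists_clm_injOn
  obtain ⟨w₀, hw₀F, hw₀, hmin₀⟩ := h.exists_vertex_forall_le hF (-ℓ)
  suffices H : ∀ w, {w} ∈ Δ → w ∈ F → f w = f w₀ from (H u hu huF).trans (H v hv hvF).symm
  intro w hw hwF
  by_contra hne
  obtain ⟨b, hb, hbmin⟩ := Finset.exists_min_image
    {w ∈ V | {w} ∈ Δ ∧ w ∈ F ∧ f w ≠ f w₀} ℓ
    ⟨w, Finset.mem_filter.2 ⟨h.mem_vertices hw, hw, hwF, hne⟩⟩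
  obtain ⟨hbV, hb, hbF, hbne⟩ := Finset.mem_filter.1 hb
  have hlt : (-ℓ) b < (-ℓ) w₀ := lt_of_le_of_ne (hmin₀ b hbF) fun heq =>
    hbne (congrArg f (hℓ hbV (h.mem_vertices hw₀) (by simpa using heq)))
  obtain ⟨e, he, heF, hdim, hbe, -, q, hq, hbq⟩ := h.exists_edge hb hF hbF (-ℓ) hw₀F hlt
  obtain ⟨a, hae, ha, hamin⟩ := h.exists_vertex_forall_le he (-ℓ)
  have hab : ℓ a < ℓ b := by simpa using hbq.trans_le (hamin q hq)
  have hfa : f a = f w₀ := by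
    by_contra hfa
    exact hab.not_ge (hbmin a (Finset.mem_filter.2 ⟨h.mem_vertices ha, ha, heF hae, hfa⟩))
  refine hbne ((hf b a hb ha hbF (heF hae) ?_).trans hfa)
  have h1 : c e ⊆ c {b} ∩ c {a} := Finset.subset_inter
    ((h.subset_singleton_iff hb he).2 hbe) ((h.subset_singleton_iff ha he).2 hae)
  have h2 := Finset.card_le_card h1
  have h3 := h.card e he
  have h4 : (c {b} ∩ c {a}).card < (c {b}).card := by
    refine Finset.card_lt_card (Finset.ssubset_iff_subset_ne.2 ⟨Finset.inter_subset_left, ?_⟩)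
    intro heq
    have hsub := Finset.inter_eq_left.1 heq
    rw [h.subset_singleton_iff ha hb] at hsub
    exact hab.ne (congrArg ℓ (Set.mem_singleton_iff.1 hsub))
  rw [h.card_singleton hb] at h4
  omega

end IsFaceCoding

/-- Möbius inversion on the subsets of `S`: if the weights of the `i` with `A ⊆ m i` add up to `1`
for every `A ⊆ S`, then only the value at `S` survives in a weighted sum. -/
theorem Finset.sum_mul_eq_of_forall_sum_eq_one {ι α R : Type*} [DecidableEq α] [CommRing R]
    (I : Finset ι) (S : Finset α) (m : ι → Finset α) (hm : ∀ i ∈ I, m i ⊆ S) (s : ι → R)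
    (hs : ∀ A ⊆ S, ∑ i ∈ I with A ⊆ m i, s i = 1) (φ : Finset α → R) :
    ∑ i ∈ I, s i * φ (m i) = φ S := by
  classical
  have hsum : ∀ A ⊆ S, ∑ B ∈ S.powerset with A ⊆ B, ∑ i ∈ I with m i = B, s i = 1 := by
    intro A hA
    rw [← hs A hA, ← Finset.sum_fiberwise_of_maps_to (s := {i ∈ I | A ⊆ m i}) (g := m)
      (t := {B ∈ S.powerset | A ⊆ B})]
    · refine Finset.sum_congr rfl fun B hB => Finset.sum_congr ?_ fun _ _ => rfl
      ext i
      simp only [Finset.mem_filter] at hB ⊢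
      grind
    · intro i hi
      simp only [Finset.mem_filter, Finset.mem_powerset] at hi ⊢
      exact ⟨hm i hi.1, hi.2⟩
  have hfib : ∀ k : ℕ, ∀ A ⊆ S, (S \ A).card = k →
      ∑ i ∈ I with m i = A, s i = if A = S then 1 else 0 := by
    intro k
    induction k using Nat.strong_induction_on with
    | _ k ih =>
      intro A hA hk
      have h1 := hsum A hA
      have hAmem : A ∈ {B ∈ S.powerset | A ⊆ B} := by simp [hA]
      rw [← Finset.add_sum_erase _ _ hAmem, Finset.sum_congr rfl (g := fun B =>
        if B = S then (1 : R) else 0)] at h1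
      · rw [Finset.sum_ite_eq'] at h1
        by_cases hAS : A = S
        · simpa [hAS] using h1
        · have : S ∈ ({B ∈ S.powerset | A ⊆ B} : Finset _).erase A := by
            simp [hA, Ne.symm hAS]
          rw [if_pos this] at h1
          rw [if_neg hAS]
          simpa using h1
      · intro B hB
        simp only [Finset.mem_erase, Finset.mem_filter, Finset.mem_powerset] at hB
        refine ih _ ?_ B hB.2.1 rfl
        rw [← hk, Finset.card_sdiff_of_subset hA, Finset.card_sdiff_of_subset hB.2.1]
        have h2 := Finset.card_lt_card (Finset.ssubset_iff_subset_ne.2 ⟨hB.2.2, Ne.symm hB.1⟩)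
        have h3 := Finset.card_le_card hB.2.1
        omega
  rw [← Finset.sum_fiberwise_of_maps_to (t := S.powerset) (g := m)
    fun i hi => Finset.mem_powerset.2 (hm i hi)]
  calc ∑ A ∈ S.powerset, ∑ i ∈ I with m i = A, s i * φ (m i)
      = ∑ A ∈ S.powerset, if A = S then φ A else 0 := by
        refine Finset.sum_congr rfl fun A hA => ?_
        rw [Finset.sum_congr rfl (g := fun i => s i * φ A)
          fun i hi => by rw [(Finset.mem_filter.1 hi).2], ← Finset.sum_mul,
          hfib _ A (Finset.mem_powerset.1 hA) rfl]
        split_ifs <;> simp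
    _ = φ S := by simp

theorem coordProj_mem_coordSubspace (A : Finset (Fin d)) (z : Fin d → ℂ) :
    coordProj d A z ∈ coordSubspace d A := fun _ ht => if_neg ht

theorem coordSubspace_mono {A B : Finset (Fin d)} (h : A ⊆ B) :
    coordSubspace d A ⊆ coordSubspace d B := fun _ hz t ht => hz t fun htA => ht (h htA)

theorem coordProj_eq_of_mem {A B : Finset (Fin d)} {z : Fin d → ℂ} (hz : z ∈ coordSubspace d B) :
    coordProj d A z = coordProj d (A ∩ B) z := by
  funext t
  by_cases hB : t ∈ B <;> simp [coordProj, hB, hz t]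

theorem coordProj_eq_self {A : Finset (Fin d)} {z : Fin d → ℂ} (hz : z ∈ coordSubspace d A) :
    coordProj d A z = z := by
  funext t
  by_cases hA : t ∈ A <;> simp [coordProj, hA, hz t]

/-- The inclusion-exclusion formula recovers the given functions on the components. -/
theorem IsFaceCoding.sum_eq {V : Finset (EuclideanSpace ℝ (Fin n))}
    {Δ : Finset (Set (EuclideanSpace ℝ (Fin n)))}
    {c : Set (EuclideanSpace ℝ (Fin n)) → Finset (Fin d)} (h : IsFaceCoding V Δ c)
    {vtx : Set (EuclideanSpace ℝ (Fin n)) → Set (EuclideanSpace ℝ (Fin n))}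
    (hvtx : ∀ σ ∈ Δ, vtx σ ∈ Δ ∧ faceDim (vtx σ) = 0 ∧ vtx σ ⊆ σ)
    {G : Set (EuclideanSpace ℝ (Fin n)) → (Fin d → ℂ) → ℂ}
    (hG : ∀ σ ∈ Δ, ∀ τ ∈ Δ, faceDim σ = 0 → faceDim τ = 0 →
      (c σ ∩ c τ).card = n - 1 →
      ∀ z ∈ coordSubspace d (c σ) ∩ coordSubspace d (c τ), G σ z = G τ z)
    {σ : Set (EuclideanSpace ℝ (Fin n))} (hσ : σ ∈ Δ) (hσ0 : faceDim σ = 0) {z : Fin d → ℂ}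
    (hz : z ∈ coordSubspace d (c σ)) :
    ∑ τ ∈ Δ, (-1 : ℂ) ^ faceDim τ * G (vtx τ) (coordProj d (c τ) z) = G σ z := by
  classical
  obtain ⟨v, rfl⟩ := exists_eq_singleton_of_faceDim_eq_zero ((h.mem_iff _).1 hσ).1 hσ0
  have hterm : ∀ τ ∈ Δ, G (vtx τ) (coordProj d (c τ) z) =
      G {v} (coordProj d (c τ ∩ c {v}) z) := by
    intro τ hτ
    obtain ⟨hvτ, hvτ0, hvττ⟩ := hvtx τ hτ
    obtain ⟨u, hu⟩ := exists_eq_singleton_of_faceDim_eq_zero ((h.mem_iff _).1 hvτ).1 hvτ0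
    rw [hu] at hvτ hvττ ⊢
    rw [coordProj_eq_of_mem hz]
    obtain ⟨υ, hυ, hvυ, hcυ⟩ := h.exists_eq_of_subset hσ
      (Finset.inter_subset_right : c τ ∩ c {v} ⊆ c {v})
    have hτυ : τ ⊆ υ := (h.rev _ hτ _ hυ).2 (hcυ ▸ Finset.inter_subset_left)
    rw [← hcυ]
    refine h.eq_of_forall_edge hυ (fun w => G {w} (coordProj d (c υ) z)) ?_ hvτ hσ
      (hτυ (hvττ rfl)) hvυ
    intro a b ha hb haυ hbυ hab
    have hmem := coordProj_mem_coordSubspace (c υ) z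
    exact hG _ ha _ hb (faceDim_singleton a) (faceDim_singleton b) hab _
      ⟨coordSubspace_mono ((h.subset_singleton_iff ha hυ).2 haυ) hmem,
        coordSubspace_mono ((h.subset_singleton_iff hb hυ).2 hbυ) hmem⟩
  rw [Finset.sum_congr rfl fun τ hτ => by rw [hterm τ hτ],
    Finset.sum_mul_eq_of_forall_sum_eq_one Δ (c {v}) (fun τ => c τ ∩ c {v})
      (fun _ _ => Finset.inter_subset_right) (fun τ => (-1 : ℂ) ^ faceDim τ) ?_
      (fun A => G {v} (coordProj d A z)), coordProj_eq_self hz]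
  intro A hA
  obtain ⟨Q, hQ, -, rfl⟩ := h.exists_eq_of_subset hσ hA
  rw [Finset.filter_congr (q := fun τ => τ ⊆ Q) fun τ hτ => by
    simp [h.rev _ hτ _ hQ, Finset.subset_inter_iff, hA]]
  have := congrArg (Int.cast : ℤ → ℂ) (h.sum_neg_one_pow_faceDim hQ)
  push_cast at this
  exact this

end Faces

/-- **Gluing: the kernel of `δ⁰` is the image of the global functions.**
Let `Δ` be the complex of nonempty faces of a polytope `P`, corresponding
(inclusion-reversingly, via `σ ↦ c σ`) to the strata of
`X = V(SR(Σ)) ⊆ ℂ^d`: the stratum-closure of `σ` is the coordinate subspace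
`ℂ^{c σ}`, of dimension `n - dim σ`; the top-dimensional components `Xᵢ` of `X`
correspond to the vertices of `Δ`.  If `(g_i)` is a tuple of holomorphic functions
on the components satisfying the codimension-one matching conditions (`ker δ⁰`),
then it is the restriction of a unique global holomorphic function `g` on `X`,
given explicitly by the inclusion-exclusion formula
`g = ∑_{σ ∈ Δ} (-1)^{dim σ} (g_i)|_{σ°}` (each stratum function lifted to `X` via
the coordinate projection, through any choice `vtx σ` of a vertex of `σ`). -/
theorem kernel_of_cech_delta0_is_global_functions
    {n d : ℕ} (P : Set (EuclideanSpace ℝ (Fin n)))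
    (V : Finset (EuclideanSpace ℝ (Fin n)))
    (hP : P = convexHull ℝ (V : Set (EuclideanSpace ℝ (Fin n))))
    (hfull : faceDim P = n)
    (Δ : Finset (Set (EuclideanSpace ℝ (Fin n))))
    (hΔ : ∀ F : Set (EuclideanSpace ℝ (Fin n)), F ∈ Δ ↔ IsPolyFace P F)
    (c : Set (EuclideanSpace ℝ (Fin n)) → Finset (Fin d))
    (hc_inj : ∀ σ ∈ Δ, ∀ τ ∈ Δ, c σ = c τ → σ = τ)
    (hc_rev : ∀ σ ∈ Δ, ∀ τ ∈ Δ, (σ ⊆ τ ↔ c τ ⊆ c σ))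
    (hc_card : ∀ σ ∈ Δ, (c σ).card + faceDim σ = n)
    (hc_inter : ∀ σ ∈ Δ, ∀ τ ∈ Δ, ∀ ρ ∈ Δ, σ ⊆ ρ → τ ⊆ ρ →
      ∃ υ ∈ Δ, c υ = c σ ∩ c τ)
    (vtx : Set (EuclideanSpace ℝ (Fin n)) → Set (EuclideanSpace ℝ (Fin n)))
    (hvtx : ∀ σ ∈ Δ, vtx σ ∈ Δ ∧ faceDim (vtx σ) = 0 ∧ vtx σ ⊆ σ)
    (G : Set (EuclideanSpace ℝ (Fin n)) → (Fin d → ℂ) → ℂ)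
    (hG_hol : ∀ σ ∈ Δ, faceDim σ = 0 → ∀ z ∈ coordSubspace d (c σ),
      DifferentiableWithinAt ℂ (G σ) (coordSubspace d (c σ)) z)
    (hG_match : ∀ σ ∈ Δ, ∀ τ ∈ Δ, faceDim σ = 0 → faceDim τ = 0 →
      (c σ ∩ c τ).card = n - 1 →
      ∀ z ∈ coordSubspace d (c σ) ∩ coordSubspace d (c τ), G σ z = G τ z) :
    ∃ g : (Fin d → ℂ) → ℂ,
      (∀ σ ∈ Δ, faceDim σ = 0 → ∀ z ∈ coordSubspace d (c σ), g z = G σ z) ∧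
      (∀ σ ∈ Δ, faceDim σ = 0 → ∀ z ∈ coordSubspace d (c σ),
        DifferentiableWithinAt ℂ g (coordSubspace d (c σ)) z) ∧
      (∀ σ ∈ Δ, faceDim σ = 0 → ∀ z ∈ coordSubspace d (c σ),
        g z = ∑ τ ∈ Δ, (-1 : ℂ) ^ faceDim τ * G (vtx τ) (coordProj d (c τ) z)) ∧
      (∀ g' : (Fin d → ℂ) → ℂ,
        (∀ σ ∈ Δ, faceDim σ = 0 → ∀ z ∈ coordSubspace d (c σ), g' z = G σ z) →
        ∀ σ ∈ Δ, faceDim σ = 0 → ∀ z ∈ coordSubspace d (c σ), g' z = g z) := by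
  have h : IsFaceCoding V Δ c := ⟨hP ▸ hfull, hP ▸ hΔ, hc_inj, hc_rev, hc_card, hc_inter⟩
  have key := fun σ (hσ : σ ∈ Δ) (hσ0 : faceDim σ = 0) z (hz : z ∈ coordSubspace d (c σ)) =>
    h.sum_eq hvtx hG_match hσ hσ0 hz
  refine ⟨fun z => ∑ τ ∈ Δ, (-1 : ℂ) ^ faceDim τ * G (vtx τ) (coordProj d (c τ) z), key,
    fun σ hσ hσ0 z hz => ?_, fun _ _ _ _ _ => rfl, fun g' hg' σ hσ hσ0 z hz => ?_⟩
  · exact (hG_hol σ hσ hσ0 z hz).congr (fun y hy => key σ hσ hσ0 y hy) (key σ hσ hσ0 z hz)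
  · exact (hg' σ hσ hσ0 z hz).trans (key σ hσ hσ0 z hz).symm
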